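/- Fix α ∈ (0,1). Under the principal factor adjustment with true factors, suppose for each θ ∈ {0.5, 1} the positive constants c_{m,θ}, c_{m−s,θ} satisfy: (i) m·c_{m,θ} ≥ (m−s)·c_{m−s,θ}; and (ii) for a null vector z⁰' ~ N(0, Σ̃_{I_0}) of dimension m−s (Σ̃_{I_0} the principal submatrix of Σ̃ on I_0), P(V_{m−s,θ}(z⁰') > c_{m−s,θ}) < α/2. Then the adaptive estimator π̂(Z) = max{π̂_{0.5}(Z; c_{m,0.5}), π̂_1(Z; c_{m,1})} satisfies P(π̂(Z) ≤ π) ≥ 1 − α. -/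

import Mathlib

open MeasureTheory ProbabilityTheory Filter

noncomputable section

/-- Standard normal CDF `Φ`. -/
def Phi (t : ℝ) : ℝ := ((gaussianReal 0 1) (Set.Iic t)).toReal

/-- Standard normal upper tail `Φ̄(t) = 1 − Φ(t)`. -/
def PhiBar (t : ℝ) : ℝ := 1 - Phi t

/-- Standard normal density `φ`. -/
def stdPhi (t : ℝ) : ℝ := Real.exp (-(t ^ 2) / 2) / Real.sqrt (2 * Real.pi)

/-- Positive part `[x]₊`. -/
def posPart' (x : ℝ) : ℝ := max x 0

/-- A correlation matrix: symmetric positive semidefinite with unit diagonal. -/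
def IsCorrMatrix {ι : Type*} [Fintype ι] (S : Matrix ι ι ℝ) : Prop :=
  S.PosSemidef ∧ ∀ i, S i i = 1

/-- `X` is a Gaussian random vector with mean `μ` and covariance `S`:
every linear functional of `X` has the corresponding one-dimensional Gaussian law. -/
def HasLawGaussian {Ω : Type*} [MeasureSpace Ω] {ι : Type*} [Fintype ι]
    (X : Ω → ι → ℝ) (μ : ι → ℝ) (S : Matrix ι ι ℝ) : Prop :=
  (∀ i, Measurable fun ω => X ω i) ∧
  ∀ c : ι → ℝ,
    Measure.map (fun ω => ∑ i, c i * X ω i) volume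
      = gaussianReal (∑ i, c i * μ i) (∑ i, ∑ j, c i * S i j * c j).toNNReal

/-- number of exceedances `Σ_i 1{x_i > t}` (as a real number). -/
def exceedCount {ι : Type*} [Fintype ι] (x : ι → ℝ) (t : ℝ) : ℝ :=
  ∑ i, if t < x i then (1 : ℝ) else 0

/-- the quantity inside the supremum defining `π̂_θ(x; c)`. -/
def piHatTerm {ι : Type*} [Fintype ι] (θ c : ℝ) (x : ι → ℝ) (t : ℝ) : ℝ :=
  ((Fintype.card ι : ℝ)⁻¹ * exceedCount x t - PhiBar t - c * PhiBar t ^ θ) / (1 - PhiBar t)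

/-- the estimator `π̂_θ(x; c) = sup_{t>0} [...]`. -/
def piHat {ι : Type*} [Fintype ι] (θ c : ℝ) (x : ι → ℝ) : ℝ :=
  sSup {y : ℝ | ∃ t : ℝ, 0 < t ∧ y = piHatTerm θ c x t}

/-- the quantity inside the supremum defining `V_{n,θ}(x⁰)`. -/
def VTerm {ι : Type*} [Fintype ι] (θ : ℝ) (x : ι → ℝ) (t : ℝ) : ℝ :=
  |(Fintype.card ι : ℝ)⁻¹ * exceedCount x t - PhiBar t| / PhiBar t ^ θ

/-- the statistic `V_{n,θ}(x⁰) = sup_{t>0} |...| / Φ̄(t)^θ`. -/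
def Vstat {ι : Type*} [Fintype ι] (θ : ℝ) (x : ι → ℝ) : ℝ :=
  sSup {y : ℝ | ∃ t : ℝ, 0 < t ∧ y = VTerm θ x t}

/-- the discretization grid `𝕋 = [√(log log m), √(5 log m)] ∩ ℕ`. -/
def TT (m : ℕ) : Finset ℕ :=
  (Finset.range (m + 1)).filter
    (fun t => Real.sqrt (Real.log (Real.log (m : ℝ))) ≤ (t : ℝ) ∧
      (t : ℝ) ≤ Real.sqrt (5 * Real.log (m : ℝ)))

/-- the discretization grid `𝕋' = [√lo, √(5 log m)] ∩ ℕ` with a general lower endpoint `√lo`. -/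
def TTlo (m : ℕ) (lo : ℝ) : Finset ℕ :=
  (Finset.range (m + 1)).filter
    (fun t => Real.sqrt lo ≤ (t : ℝ) ∧ (t : ℝ) ≤ Real.sqrt (5 * Real.log (m : ℝ)))

/-- maximum of `f` over a finite grid (as `sSup` of the image, `= 0` for the empty grid). -/
def gridMax (S : Finset ℕ) (f : ℝ → ℝ) : ℝ :=
  sSup {y : ℝ | ∃ t ∈ S, y = f (t : ℝ)}

/-- the discretized estimator `π̂*_θ(x; c) = max_{t ∈ 𝕋} [...]`. -/
def piHatStar {ι : Type*} [Fintype ι] (m : ℕ) (θ c : ℝ) (x : ι → ℝ) : ℝ :=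
  gridMax (TT m) (piHatTerm θ c x)

/-- the discretized statistic `V*_{n,θ}(x⁰) = max_{t ∈ 𝕋} |...| / Φ̄(t)^θ`. -/
def VstatStar {ι : Type*} [Fintype ι] (m : ℕ) (θ : ℝ) (x : ι → ℝ) : ℝ :=
  gridMax (TT m) (VTerm θ x)

/-- probability of an event, as a real number. -/
def Pr {Ω : Type*} [MeasureSpace Ω] (A : Set Ω) : ℝ := (volume A).toReal

/-- conditional probability `P(A | E)`, as a real number. -/
def PrCond {Ω : Type*} [MeasureSpace Ω] (E A : Set Ω) : ℝ :=
  ((ProbabilityTheory.cond volume E) A).toReal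


/-- Data of the multivariate Gaussian model together with a principal factor
decomposition of its correlation matrix using `k` factors. -/
structure PFAData (Ω : Type) [MeasureSpace Ω] (m : ℕ) where
  /-- mean vector -/
  μ : Fin m → ℝ
  /-- correlation matrix -/
  S : Matrix (Fin m) (Fin m) ℝ
  hS : IsCorrMatrix S
  /-- eigenvalues, sorted non-increasingly, nonnegative -/
  lam : Fin m → ℝ
  hlam_nonneg : ∀ i, 0 ≤ lam i
  hlam_anti : ∀ i j : Fin m, i ≤ j → lam j ≤ lam i
  /-- orthonormal eigenvectors: `ev l` is the `l`-th eigenvector -/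
  ev : Fin m → Fin m → ℝ
  horth : ∀ l l' : Fin m, ∑ i, ev l i * ev l' i = if l = l' then (1:ℝ) else 0
  hspec : ∀ i j, S i j = ∑ l, lam l * ev l i * ev l j
  /-- number of principal factors -/
  k : ℕ
  hk1 : 1 ≤ k
  hkm : k < m
  /-- principal factors -/
  W : Ω → Fin k → ℝ
  /-- residual noise -/
  K : Ω → Fin m → ℝ
  /-- observed statistics -/
  X : Ω → Fin m → ℝ
  hW : HasLawGaussian W 0 (1 : Matrix (Fin k) (Fin k) ℝ)
  hK : HasLawGaussian K 0
    (fun i j => ∑ l : Fin m, if k ≤ (l : ℕ) then lam l * ev l i * ev l j else 0)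
  hWK : IndepFun W K volume
  hbnorm : ∀ i : Fin m, ∑ j : Fin k,
    (Real.sqrt (lam (Fin.castLE hkm.le j)) * ev (Fin.castLE hkm.le j) i) ^ 2 < 1
  hX : ∀ ω i, X ω i = μ i
    + (∑ j : Fin k, Real.sqrt (lam (Fin.castLE hkm.le j)) * ev (Fin.castLE hkm.le j) i * W ω j)
    + K ω i

namespace PFAData

variable {Ω : Type} [MeasureSpace Ω] {m : ℕ} (D : PFAData Ω m)

/-- rows of the loading matrix `L = (√λ₁γ₁, …, √λ_kγ_k)`. -/
def b (i : Fin m) (j : Fin D.k) : ℝ :=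
  Real.sqrt (D.lam (Fin.castLE D.hkm.le j)) * D.ev (Fin.castLE D.hkm.le j) i

/-- the amplification factors `a_i = (1 − ‖b_i‖₂²)^{−1/2}`. -/
def a (i : Fin m) : ℝ := (Real.sqrt (1 - ∑ j, D.b i j ^ 2))⁻¹

/-- residual covariance `A = Σ_{l>k} λ_l γ_l γ_lᵀ`. -/
def A : Matrix (Fin m) (Fin m) ℝ :=
  fun i j => ∑ l : Fin m, if D.k ≤ (l : ℕ) then D.lam l * D.ev l i * D.ev l j else 0

/-- the correlation matrix `Σ̃` standardizing `A`. -/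
def St : Matrix (Fin m) (Fin m) ℝ :=
  fun i j => D.A i j / Real.sqrt (D.A i i * D.A j j)

/-- dependence-adjusted statistics (true factors): `Z_i = a_i(X_i − b_iᵀW)`. -/
def Z (ω : Ω) (i : Fin m) : ℝ := D.a i * (D.X ω i - ∑ j, D.b i j * D.W ω j)

/-- `a_min = min_i a_i`. -/
def amin : ℝ := ⨅ i, D.a i

/-- `a_max = max_i a_i`. -/
def amax : ℝ := ⨆ i, D.a i

/-- `ẑ` built from data `x` and an estimated factor vector `wh`. -/
def zhat (x : Fin m → ℝ) (wh : Fin D.k → ℝ) (i : Fin m) : ℝ :=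
  D.a i * (x i - ∑ j, D.b i j * wh j)

/-- `wh` is an `L¹` factor estimate for the data `x`. -/
def IsL1FactorEstimate (x : Fin m → ℝ) (wh : Fin D.k → ℝ) : Prop :=
  ∀ β : Fin D.k → ℝ, ∑ i, |x i - ∑ j, D.b i j * wh j| ≤ ∑ i, |x i - ∑ j, D.b i j * β j|

end PFAData

lemma gauss_open_pos {U : Set ℝ} (hU : IsOpen U) (hne : U.Nonempty) :
    0 < (gaussianReal 0 1) U := by
  rw [pos_iff_ne_zero]
  intro h
  have := gaussianReal_absolutelyContinuous' 0 (one_ne_zero (α := NNReal)) h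
  exact (hU.measure_pos volume hne).ne' this

lemma Phi_eq_cdf (t : ℝ) : Phi t = cdf (gaussianReal 0 1) t := by
  rw [cdf_eq_real]; rfl

lemma Phi_pos (t : ℝ) : 0 < Phi t := by
  unfold Phi
  refine ENNReal.toReal_pos ?_ (measure_ne_top _ _)
  exact ((gauss_open_pos isOpen_Iio ⟨t - 1, by simp⟩).trans_le
    (measure_mono (Set.Iio_subset_Iic_self (a := t)))).ne'

lemma PhiBar_pos (t : ℝ) : 0 < PhiBar t := by
  have h : PhiBar t = (gaussianReal 0 1).real (Set.Ioi t) := by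
    rw [← Set.compl_Iic, probReal_compl_eq_one_sub measurableSet_Iic]; rfl
  rw [h]
  exact ENNReal.toReal_pos (gauss_open_pos isOpen_Ioi ⟨t + 1, by simp⟩).ne' (measure_ne_top _ _)

lemma PhiBar_lt_one (t : ℝ) : PhiBar t < 1 := by
  have := Phi_pos t
  unfold PhiBar; linarith

lemma PhiBar_anti {a b : ℝ} (h : a ≤ b) : PhiBar b ≤ PhiBar a := by
  unfold PhiBar
  rw [Phi_eq_cdf, Phi_eq_cdf]
  linarith [monotone_cdf (gaussianReal 0 1) h]

lemma PhiBar_rc (t : ℝ) : ContinuousWithinAt PhiBar (Set.Ici t) t := by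
  have h : PhiBar = fun t => 1 - cdf (gaussianReal 0 1) t := by
    funext u; rw [← Phi_eq_cdf]; rfl
  rw [h]
  exact continuousWithinAt_const.sub ((cdf (gaussianReal 0 1)).right_continuous t)

lemma exceed_nonneg {ι : Type*} [Fintype ι] (x : ι → ℝ) (t : ℝ) : 0 ≤ exceedCount x t :=
  Finset.sum_nonneg fun i _ => by split_ifs <;> norm_num

lemma exceed_le {ι : Type*} [Fintype ι] (x : ι → ℝ) (t : ℝ) :
    exceedCount x t ≤ Fintype.card ι := by
  unfold exceedCount
  calc _ ≤ ∑ _i : ι, (1 : ℝ) := Finset.sum_le_sum fun i _ => by split_ifs <;> norm_num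
    _ = _ := by simp

lemma exceed_rc {ι : Type*} [Fintype ι] (x : ι → ℝ) (t : ℝ) :
    ContinuousWithinAt (exceedCount x) (Set.Ici t) t := by
  unfold exceedCount
  refine tendsto_finsetSum _ fun i _ => ?_
  by_cases h : t < x i
  · refine Tendsto.congr' ?_ tendsto_const_nhds
    filter_upwards [mem_nhdsWithin_of_mem_nhds (Iio_mem_nhds h)] with u hu
    simp only [Set.mem_Iio] at hu
    simp [h, hu]
  · refine Tendsto.congr' ?_ tendsto_const_nhds
    filter_upwards [self_mem_nhdsWithin] with u hu
    have : ¬ u < x i := fun h' => h (lt_of_le_of_lt hu h')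
    simp [h, this]

lemma VTerm_rc {ι : Type*} [Fintype ι] (θ : ℝ) (x : ι → ℝ) (t : ℝ) :
    ContinuousWithinAt (VTerm θ x) (Set.Ici t) t := by
  unfold VTerm
  refine ContinuousWithinAt.div ?_ ?_ (Real.rpow_pos_of_pos (PhiBar_pos t) θ).ne'
  · exact ((continuousWithinAt_const.mul (exceed_rc x t)).sub (PhiBar_rc t)).abs
  · exact (PhiBar_rc t).rpow_const (Or.inl (PhiBar_pos t).ne')

lemma VTerm_bdd {ι : Type*} [Fintype ι] {θ : ℝ} (h0 : 0 ≤ θ) (h1 : θ ≤ 1) (x : ι → ℝ) :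
    BddAbove {y : ℝ | ∃ t : ℝ, 0 < t ∧ y = VTerm θ x t} := by
  obtain ⟨M, hM⟩ : ∃ M : ℝ, ∀ i, x i ≤ M := by
    obtain ⟨M, hM⟩ := (Set.finite_range x).bddAbove
    exact ⟨M, fun i => hM ⟨i, rfl⟩⟩
  refine ⟨1 + 1 / PhiBar M ^ θ, ?_⟩
  rintro y ⟨t, -, rfl⟩
  have hp := PhiBar_pos t
  have hp1 := PhiBar_lt_one t
  have hpt := Real.rpow_pos_of_pos hp θ
  have hpM := Real.rpow_pos_of_pos (PhiBar_pos M) θ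
  unfold VTerm
  by_cases h : t < M
  · have hle : PhiBar M ^ θ ≤ PhiBar t ^ θ :=
      Real.rpow_le_rpow (PhiBar_pos M).le (PhiBar_anti h.le) h0
    have hn0 : 0 ≤ (Fintype.card ι : ℝ)⁻¹ * exceedCount x t :=
      mul_nonneg (by positivity) (exceed_nonneg x t)
    have hn1 : (Fintype.card ι : ℝ)⁻¹ * exceedCount x t ≤ 1 := by
      calc _ ≤ (Fintype.card ι : ℝ)⁻¹ * Fintype.card ι :=
            mul_le_mul_of_nonneg_left (exceed_le x t) (by positivity)
        _ ≤ 1 := inv_mul_le_one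
    have habs : |(Fintype.card ι : ℝ)⁻¹ * exceedCount x t - PhiBar t| ≤ 1 := by
      rw [abs_le]; constructor <;> linarith
    have : |(Fintype.card ι : ℝ)⁻¹ * exceedCount x t - PhiBar t| / PhiBar t ^ θ
        ≤ 1 / PhiBar M ^ θ := div_le_div₀ zero_le_one habs hpM hle
    linarith
  · have hz : exceedCount x t = 0 := by
      unfold exceedCount
      refine Finset.sum_eq_zero fun i _ => ?_
      rw [if_neg]
      exact not_lt.2 ((hM i).trans (not_lt.1 h))
    rw [hz, mul_zero, zero_sub, abs_neg, abs_of_pos hp]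
    have h3 : PhiBar t ≤ PhiBar t ^ θ := by
      simpa using Real.rpow_le_rpow_of_exponent_ge hp hp1.le h1
    have : PhiBar t / PhiBar t ^ θ ≤ 1 := (div_le_one hpt).2 h3
    have : 0 < 1 / PhiBar M ^ θ := by positivity
    linarith

lemma lt_Vstat_iff {ι : Type*} [Fintype ι] {θ : ℝ} (h0 : 0 ≤ θ) (h1 : θ ≤ 1) (x : ι → ℝ) (c : ℝ) :
    c < Vstat θ x ↔ ∃ t : ℝ, 0 < t ∧ c < VTerm θ x t := by
  unfold Vstat
  rw [lt_csSup_iff (VTerm_bdd h0 h1 x) ⟨_, 1, one_pos, rfl⟩]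
  constructor
  · rintro ⟨_, ⟨t, ht, rfl⟩, h⟩; exact ⟨t, ht, h⟩
  · rintro ⟨t, ht, h⟩; exact ⟨_, ⟨t, ht, rfl⟩, h⟩

lemma lt_Vstat_iff_rat {ι : Type*} [Fintype ι] {θ : ℝ} (h0 : 0 ≤ θ) (h1 : θ ≤ 1)
    (x : ι → ℝ) (c : ℝ) :
    c < Vstat θ x ↔ ∃ q : ℚ, (0 : ℝ) < q ∧ c < VTerm θ x q := by
  rw [lt_Vstat_iff h0 h1]
  constructor
  · rintro ⟨t, ht, h⟩
    have hev : ∀ᶠ u in nhdsWithin t (Set.Ici t), c < VTerm θ x u :=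
      (VTerm_rc θ x t).eventually (lt_mem_nhds h)
    obtain ⟨u, hu, hsub⟩ := (mem_nhdsGE_iff_exists_Ico_subset).1 hev
    obtain ⟨q, hq1, hq2⟩ := exists_rat_btwn (Set.mem_Ioi.1 hu)
    exact ⟨q, ht.trans hq1, hsub ⟨hq1.le, hq2⟩⟩
  · rintro ⟨q, hq, h⟩; exact ⟨q, hq, h⟩

lemma meas_Vset {ι : Type*} [Fintype ι] {θ : ℝ} (h0 : 0 ≤ θ) (h1 : θ ≤ 1) (c : ℝ) :
    MeasurableSet {x : ι → ℝ | c < Vstat θ x} := by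
  have : {x : ι → ℝ | c < Vstat θ x} =
      ⋃ q : ℚ, {x : ι → ℝ | (0 : ℝ) < q ∧ c < VTerm θ x q} := by
    ext x
    simp only [Set.mem_ofPred_eq, Set.mem_iUnion]
    exact lt_Vstat_iff_rat h0 h1 x c
  rw [this]
  refine MeasurableSet.iUnion fun q => ?_
  refine (MeasurableSet.const ((0 : ℝ) < q)).inter ?_
  refine measurableSet_lt (f := fun _ : ι → ℝ => c) (g := fun x => VTerm θ x q)
    measurable_const ?_
  unfold VTerm exceedCount
  refine Measurable.div_const ?_ _
  refine Measurable.abs ?_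
  refine Measurable.sub_const ?_ _
  refine Measurable.const_mul ?_ _
  refine Finset.measurable_sum _ fun i _ => ?_
  exact Measurable.ite (measurableSet_lt measurable_const (measurable_pi_apply i))
    measurable_const measurable_const

lemma law_ext {Ω : Type*} [MeasureSpace Ω] [IsProbabilityMeasure (volume : Measure Ω)]
    {ι : Type*} [Fintype ι] (X Y : Ω → ι → ℝ) (hX : Measurable X) (hY : Measurable Y)
    (h : ∀ c : ι → ℝ, Measure.map (fun ω => ∑ i, c i * X ω i) volume
      = Measure.map (fun ω => ∑ i, c i * Y ω i) volume) :
    Measure.map X volume = Measure.map Y volume := by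
  classical
  have := Measure.isProbabilityMeasure_map (μ := (volume : Measure Ω)) hX.aemeasurable
  have := Measure.isProbabilityMeasure_map (μ := (volume : Measure Ω)) hY.aemeasurable
  refine Measure.ext_of_charFunDual <| funext fun L => ?_
  rw [charFunDual_eq_charFun_map_one, charFunDual_eq_charFun_map_one,
    Measure.map_map (by fun_prop) hX, Measure.map_map (by fun_prop) hY]
  have hL : ∀ x : ι → ℝ, L x = ∑ i, L (Pi.single i 1) * x i := by
    intro x
    have := LinearMap.pi_apply_eq_sum_univ (L : (ι → ℝ) →ₗ[ℝ] ℝ) x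
    simp only [ContinuousLinearMap.coe_coe, smul_eq_mul] at this
    rw [this]
    refine Finset.sum_congr rfl fun i _ => ?_
    rw [mul_comm]
    congr 2
    funext j
    simp [Pi.single_apply, eq_comm]
  have e := h fun i => L (Pi.single i 1)
  have hXe : (⇑L ∘ X) = fun ω => ∑ i, L (Pi.single i 1) * X ω i := by
    funext ω; exact hL _
  have hYe : (⇑L ∘ Y) = fun ω => ∑ i, L (Pi.single i 1) * Y ω i := by
    funext ω; exact hL _
  rw [hXe, hYe, e]

lemma sum_castLE_split {k m : ℕ} (h : k ≤ m) (f : Fin m → ℝ) :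
    ∑ l, f l = (∑ j : Fin k, f (Fin.castLE h j)) + ∑ l : Fin m, if k ≤ (l : ℕ) then f l else 0 := by
  obtain ⟨r, rfl⟩ := Nat.exists_eq_add_of_le h
  rw [Fin.sum_univ_add, Fin.sum_univ_add]
  have h1 : ∀ j : Fin k, ¬ k ≤ (j : ℕ) := fun j => by omega
  simp [h1]
  rfl

lemma sum_null {m : ℕ} (p : Fin m → Prop) [DecidablePred p] [inst : Fintype {i // p i}]
    (c : {i : Fin m // p i} → ℝ) (f : Fin m → ℝ) :
    ∑ i, (if h : p i then c ⟨i, h⟩ else 0) * f i = ∑ i : {i : Fin m // p i}, c i * f i := by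
  have hinst : inst = Subtype.fintype p := Subsingleton.elim _ _
  subst hinst
  rw [← Fintype.sum_subtype_add_sum_subtype p]
  have h2 : ∑ i : {i // ¬ p i}, (if h : p i then c ⟨i, h⟩ else 0) * f i = 0 :=
    Finset.sum_eq_zero fun i _ => by rw [dif_neg i.2, zero_mul]
  rw [h2, add_zero]
  refine Finset.sum_bij (fun i _ => i) ?_ ?_ ?_ ?_
  · intro i _; exact Finset.mem_univ _
  · intro i _ j _ h; exact h
  · intro i _; exact ⟨i, Finset.mem_univ _, rfl⟩
  · intro i _; rw [dif_pos i.2]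

/-- deterministic comparison -/
lemma det_bound {m : ℕ} (hm : 0 < m) (p : Fin m → Prop) [DecidablePred p] [Fintype {i // p i}]
    {θ : ℝ} (h0 : 0 ≤ θ) (h1 : θ ≤ 1)
    (s : ℕ) (hs : s = (Finset.univ.filter (fun i => ¬ p i)).card) (c cs : ℝ)
    (hmono : ((m : ℝ) - s) * cs ≤ (m : ℝ) * c) (z : Fin m → ℝ)
    (hV : ¬ cs < Vstat θ (fun i : {i // p i} => z i)) :
    piHat θ c z ≤ (s : ℝ) / m := by
  have hmR : (0 : ℝ) < m := by exact_mod_cast hm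
  refine csSup_le ⟨_, 1, one_pos, rfl⟩ ?_
  rintro y ⟨t, ht, rfl⟩
  rw [lt_Vstat_iff h0 h1] at hV
  push Not at hV
  have hVt := hV t ht
  set z0 : {i // p i} → ℝ := fun i => z i
  have hp := PhiBar_pos t
  have hp1 := PhiBar_lt_one t
  have hpt := Real.rpow_pos_of_pos hp θ
  have hcard : (Fintype.card {i // p i} : ℝ) + s = m := by
    have e1 : Fintype.card {i // p i} = (Finset.univ.filter p).card := Fintype.card_subtype p
    have e2 := Finset.card_filter_add_card_filter_not (s := (Finset.univ : Finset (Fin m))) p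
    rw [Finset.card_univ, Fintype.card_fin, ← e1, ← hs] at e2
    exact_mod_cast e2
  set n : ℝ := (Fintype.card {i // p i} : ℝ) with hn
  have hn0 : 0 ≤ n := Nat.cast_nonneg _
  have hcount0 : exceedCount z0 t ≤ n * (PhiBar t + cs * PhiBar t ^ θ) := by
    rcases hn0.eq_or_lt with h | h
    · have := exceed_le z0 t
      rw [← hn, ← h] at this
      rw [← h, zero_mul]; exact this
    · unfold VTerm at hVt
      rw [div_le_iff₀ hpt, ← hn] at hVt
      have h3 := (le_abs_self _).trans hVt
      have h4 : n⁻¹ * exceedCount z0 t ≤ PhiBar t + cs * PhiBar t ^ θ := by linarith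
      rwa [inv_mul_le_iff₀ h] at h4
  have hcount : exceedCount z t ≤ exceedCount z0 t + s := by
    have h5 : exceedCount z t = (∑ i : {i // p i}, if t < z i then (1 : ℝ) else 0)
        + ∑ i ∈ Finset.univ.filter (fun i => ¬ p i), if t < z i then (1 : ℝ) else 0 := by
      unfold exceedCount
      rw [← Finset.sum_filter_add_sum_filter_not Finset.univ p]
      congr 1
      rw [Finset.sum_subtype (Finset.univ.filter p) (p := p) (by simp)]
    rw [h5]
    refine add_le_add le_rfl ?_
    calc _ ≤ ∑ _i ∈ Finset.univ.filter (fun i => ¬ p i), (1 : ℝ) :=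
          Finset.sum_le_sum fun i _ => by split_ifs <;> norm_num
      _ = s := by simp [hs]
  unfold piHatTerm
  rw [Fintype.card_fin, div_le_div_iff₀ (by linarith) hmR]
  have h6 : ((m : ℝ)⁻¹ * exceedCount z t - PhiBar t - c * PhiBar t ^ θ) * m
      = exceedCount z t - m * PhiBar t - m * c * PhiBar t ^ θ := by
    field_simp
  rw [h6]
  have h7 : n = m - s := by linarith
  rw [h7] at hcount0
  have h8 := mul_le_mul_of_nonneg_right hmono hpt.le
  nlinarith

lemma A_diag {Ω : Type} [MeasureSpace Ω] {m : ℕ} (D : PFAData Ω m) (i : Fin m) :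
    D.A i i = 1 - ∑ j, D.b i j ^ 2 := by
  have h1 := D.hS.2 i
  rw [D.hspec, sum_castLE_split D.hkm.le] at h1
  have h2 : ∑ j, D.b i j ^ 2 = ∑ j : Fin D.k, D.lam (Fin.castLE D.hkm.le j)
      * D.ev (Fin.castLE D.hkm.le j) i * D.ev (Fin.castLE D.hkm.le j) i := by
    refine Finset.sum_congr rfl fun j _ => ?_
    unfold PFAData.b
    rw [mul_pow, Real.sq_sqrt (D.hlam_nonneg _)]; ring
  rw [h2]
  unfold PFAData.A
  linarith

lemma St_eq {Ω : Type} [MeasureSpace Ω] {m : ℕ} (D : PFAData Ω m) (i j : Fin m) :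
    D.St i j = D.a i * D.A i j * D.a j := by
  have hi : 0 ≤ D.A i i := by
    rw [A_diag]; exact sub_nonneg.2 (D.hbnorm i).le
  unfold PFAData.St PFAData.a
  rw [← A_diag, ← A_diag, Real.sqrt_mul hi, div_eq_mul_inv, mul_inv]
  ring

lemma Z_null {Ω : Type} [MeasureSpace Ω] {m : ℕ} (D : PFAData Ω m) (ω : Ω) (i : Fin m)
    (h : D.μ i = 0) : D.Z ω i = D.a i * D.K ω i := by
  unfold PFAData.Z
  rw [D.hX, h]
  unfold PFAData.b
  ring

lemma law_Z_null {Ω : Type} [MeasureSpace Ω] [IsProbabilityMeasure (volume : Measure Ω)]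
    {m : ℕ} (D : PFAData Ω m) (z0 : Ω → {i : Fin m // D.μ i = 0} → ℝ)
    (hz0 : HasLawGaussian z0 0 (fun i j => D.St i.1 j.1)) :
    Measurable (fun ω (i : {i : Fin m // D.μ i = 0}) => D.Z ω i) ∧ Measurable z0 ∧
    Measure.map (fun ω (i : {i : Fin m // D.μ i = 0}) => D.Z ω i) volume
      = Measure.map z0 volume := by
  have hm1 : Measurable (fun ω (i : {i : Fin m // D.μ i = 0}) => D.Z ω i) := by
    refine measurable_pi_lambda _ fun i => ?_
    simp only [Z_null D _ i.1 i.2]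
    exact (D.hK.1 i).const_mul _
  have hm2 : Measurable z0 := measurable_pi_lambda _ hz0.1
  refine ⟨hm1, hm2, law_ext _ _ hm1 hm2 fun c => ?_⟩
  rw [hz0.2 c]
  have hK := D.hK.2 (fun i => (if h : D.μ i = 0 then (c ⟨i, h⟩ * D.a i) else 0))
  have key : ∀ f : Fin m → ℝ, ∑ i, (if h : D.μ i = 0 then (c ⟨i, h⟩ * D.a i) else 0) * f i
      = ∑ i : {i : Fin m // D.μ i = 0}, (c i * D.a i) * f i := fun f =>
    sum_null (fun i => D.μ i = 0) (fun i => c i * D.a i) f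
  have e1 : (fun ω => ∑ i, (if h : D.μ i = 0 then (c ⟨i, h⟩ * D.a i) else 0) * D.K ω i)
      = fun ω => ∑ i : {i : Fin m // D.μ i = 0}, c i * D.Z ω i := by
    funext ω
    rw [key]
    refine Finset.sum_congr rfl fun i _ => ?_
    rw [Z_null D ω i.1 i.2]; ring
  rw [e1] at hK
  rw [hK]
  congr 1
  · simp
  · congr 1
    have e2 : ∀ i : Fin m, ∀ x : ℝ, ∑ j, x * D.A i j
        * (if h : D.μ j = 0 then (c ⟨j, h⟩ * D.a j) else 0)
        = x * ∑ j : {i : Fin m // D.μ i = 0}, (c j * D.a j) * D.A i j := by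
      intro i x
      rw [← key, Finset.mul_sum]
      exact Finset.sum_congr rfl fun j _ => by ring
    change ∑ i, ∑ j, (if h : D.μ i = 0 then (c ⟨i, h⟩ * D.a i) else 0) * D.A i j
        * (if h : D.μ j = 0 then (c ⟨j, h⟩ * D.a j) else 0) = _
    simp only [e2]
    rw [key]
    refine Finset.sum_congr rfl fun i _ => ?_
    rw [Finset.mul_sum]
    refine Finset.sum_congr rfl fun j _ => ?_
    rw [St_eq]; ring

/-- lower bound property of the dependence-adjusted adaptive estimator
`π̂(Z) = max{π̂_{0.5}(Z; c_{m,0.5}), π̂_1(Z; c_{m,1})}` (Lemma A.2). -/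
theorem stmt1
    {Ω : Type} [MeasureSpace Ω] [IsProbabilityMeasure (volume : Measure Ω)]
    (α : ℝ) (hα : α ∈ Set.Ioo (0:ℝ) 1)
    (m : ℕ) (D : PFAData Ω m)
    (s : ℕ) (hs : s = (Finset.univ.filter (fun i => D.μ i ≠ 0)).card)
    (c05 c1 c05s c1s : ℝ)
    (hc05 : 0 < c05) (hc1 : 0 < c1) (hc05s : 0 < c05s) (hc1s : 0 < c1s)
    (hmono05 : ((m : ℝ) - s) * c05s ≤ (m : ℝ) * c05)
    (hmono1 : ((m : ℝ) - s) * c1s ≤ (m : ℝ) * c1)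
    (z0 : Ω → {i : Fin m // D.μ i = 0} → ℝ)
    (hz0 : HasLawGaussian z0 0 (fun i j => D.St i.1 j.1))
    (hnull05 : Pr {ω | c05s < Vstat 0.5 (z0 ω)} < α / 2)
    (hnull1 : Pr {ω | c1s < Vstat 1 (z0 ω)} < α / 2) :
    1 - α ≤ Pr {ω | max (piHat 0.5 c05 (D.Z ω)) (piHat 1 c1 (D.Z ω)) ≤ (s : ℝ) / m} := by
  classical
  obtain ⟨hm1, hm2, hlaw⟩ := law_Z_null D z0 hz0
  set Y : Ω → {i : Fin m // D.μ i = 0} → ℝ := fun ω i => D.Z ω i with hY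
  have tr : ∀ θ c : ℝ, 0 ≤ θ → θ ≤ 1 → MeasurableSet {ω | c < Vstat θ (Y ω)} ∧
      (volume : Measure Ω).real {ω | c < Vstat θ (Y ω)} = Pr {ω | c < Vstat θ (z0 ω)} := by
    intro θ c h0 h1
    have hS := meas_Vset (ι := {i : Fin m // D.μ i = 0}) h0 h1 c
    refine ⟨hm1 hS, ?_⟩
    have e1 := Measure.map_apply (μ := (volume : Measure Ω)) hm1 hS
    have e2 := Measure.map_apply (μ := (volume : Measure Ω)) hm2 hS
    rw [hlaw, e2] at e1
    exact congrArg ENNReal.toReal e1.symm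
  obtain ⟨mA, pA⟩ := tr 0.5 c05s (by norm_num) (by norm_num)
  obtain ⟨mB, pB⟩ := tr 1 c1s (by norm_num) (by norm_num)
  rw [← pA] at hnull05
  rw [← pB] at hnull1
  have hU := measureReal_union_le (μ := (volume : Measure Ω))
    {ω | c05s < Vstat 0.5 (Y ω)} {ω | c1s < Vstat 1 (Y ω)}
  have hC := probReal_compl_eq_one_sub (μ := (volume : Measure Ω)) (mA.union mB)
  have hsub : ({ω | c05s < Vstat 0.5 (Y ω)} ∪ {ω | c1s < Vstat 1 (Y ω)})ᶜ ⊆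
      {ω | max (piHat 0.5 c05 (D.Z ω)) (piHat 1 c1 (D.Z ω)) ≤ (s : ℝ) / m} := by
    intro ω hω
    simp only [Set.mem_compl_iff, Set.mem_union, Set.mem_ofPred_eq, not_or] at hω
    have hm : 0 < m := lt_of_le_of_lt (Nat.zero_le _) D.hkm
    exact max_le
      (det_bound hm (fun i => D.μ i = 0) (by norm_num) (by norm_num) s (by convert hs) c05 c05s
        hmono05 (D.Z ω) hω.1)
      (det_bound hm (fun i => D.μ i = 0) (by norm_num) (by norm_num) s (by convert hs) c1 c1s
        hmono1 (D.Z ω) hω.2)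
  have hfin := measureReal_mono (μ := (volume : Measure Ω)) hsub
  change _ ≤ (volume : Measure Ω).real _
  linarith

end
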